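/- Let p_1,...,p_9 be the nine polynomials in C[x_1,x_2,x_3,x_4,x_5] defined in the context. A point (a_1,a_2,a_3,a_4,a_5) in C^5 satisfies p_i(a_1,...,a_5) = 0 for all i = 1,...,9 if and only if it lies on one of the following 96 complex lines (t ranges over C): L1: (t,0,0,0,0); L2: (0,0,0,0,t); L3: (t,-t-7/2,0,0,0); L4: (0,t,-t-7/2,0,0); L5: (0,0,t,-t-7/2,0); L6: (0,0,0,t,-t-7/2); L7: (t,-t-1,0,0,0); L8: (0,t,-t-1,0,0); L9: (0,0,t,-t-1,0); L10: (0,0,0,t,-t-1); L11: (t,-5/2,0,0,0); L12: (t,0,-5/2,0,0); L13: (t,0,0,-5/2,0); L14: (t,0,0,0,-5/2); L15: (-5/2,0,0,0,t); L16: (0,-5/2,0,0,t); L17: (0,0,-5/2,0,t); L18: (0,0,0,-5/2,t); L19: (-5/2,t,-1-t,0,0); L20: (-5/2,0,t,-1-t,0); L21: (-5/2,0,0,t,-1-t); L22: (1/2,t,-5/2-t,0,0); L23: (-1/2,0,t,-5/2-t,0); L24: (-3/2,0,0,t,-5/2-t); L25: (0,-5/2,t,-1-t,0); L26: (0,-5/2,0,t,-1-t);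 L27: (0,-1/2,t,-3/2-t,0); L28: (0,-3/2,0,t,-3/2-t); L29: (0,0,-5/2,t,-1-t); L30: (0,0,-3/2,t,-1/2-t); L31: (t,-1-t,0,0,-5/2); L32: (0,t,-1-t,0,-5/2); L33: (0,0,t,-1-t,-5/2); L34: (t,-5/2-t,0,0,-3/2); L35: (0,t,-5/2-t,0,-1/2); L36: (0,0,t,-5/2-t,1/2); L37: (t,-1-t,0,-5/2,0); L38: (0,t,-1-t,-5/2,0); L39: (t,-3/2-t,0,-3/2,0); L40: (0,t,-3/2-t,-1/2,0); L41: (t,-1-t,-5/2,0,0); L42: (t,-1/2-t,-3/2,0,0); L43: (t,1/2,-3/2,0,0); L44: (t,-1/2,0,-3/2,0); L45: (t,-3/2,0,0,-3/2); L46: (t,0,-1/2,-1/2,0); L47: (t,0,-3/2,0,-1/2); L48: (t,0,0,-3/2,1/2); L49: (1/2,-3/2,0,0,t); L50: (-1/2,0,-3/2,0,t); L51: (-3/2,0,0,-3/2,t); L52: (0,-1/2,-1/2,0,t); L53: (0,-3/2,0,-1/2,t); L54: (0,0,-3/2,1/2,t); L55: (t,-3/2,1/2,-3/2,0); L56: (t,-1/2,-1/2,0,-3/2);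 L57: (t,-3/2,0,-1/2,-1/2); L58: (t,0,-3/2,1/2,-3/2); L59: (-3/2,1/2,-3/2,0,t); L60: (-1/2,-1/2,0,-3/2,t); L61: (-3/2,0,-1/2,-1/2,t); L62: (0,-3/2,1/2,-3/2,t); L63: (t,-5/2-t,1/2,-3/2,0); L64: (t,-3/2-t,-1/2,0,-3/2); L65: (t,-5/2-t,0,-1/2,-1/2); L66: (t,-1-t,-1/2,-1/2,0); L67: (t,-1-t,-3/2,0,-1/2); L68: (t,-1-t,0,-3/2,1/2); L69: (0,t,-5/2-t,1/2,-3/2); L70: (0,t,-1-t,-3/2,1/2); L71: (-3/2,1/2,t,-5/2-t,0); L72: (-1/2,-1/2,0,t,-5/2-t); L73: (-3/2,0,-1/2,t,-3/2-t); L74: (0,-3/2,1/2,t,-5/2-t); L75: (1/2,-3/2,0,t,-1-t); L76: (-1/2,0,-3/2,t,-1-t); L77: (0,-1/2,-1/2,t,-1-t); L78: (1/2,-3/2,t,-1-t,0); L79: (t,-1/2,-1/2,-1/2,-1/2); L80: (-1/2,-1/2,-1/2,-1/2,t); L81: (t,-1-t,-3/2,1/2,-3/2); L82: (t,-3/2-t,-1/2,-1/2,-1/2);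 L83: (-3/2,1/2,-3/2,t,-1-t); L84: (-1/2,-1/2,-1/2,t,-3/2-t); L85: (0,-3/2,t,-1-t,-1/2); L86: (-3/2,0,t,-1-t,-3/2); L87: (0,-3/2,t,-1/2-t,-3/2); L88: (-1/2,-1/2,t,-1-t,-3/2); L89: (-3/2,0,t,-3/2-t,-1/2); L90: (-1/2,-1/2,t,-3/2-t,-1/2); L91: (-1/2,t,-1-t,-3/2,0); L92: (-3/2,t,-1-t,0,-3/2); L93: (-3/2,t,-1/2-t,-3/2,0); L94: (-3/2,t,-1-t,-1/2,-1/2); L95: (-1/2,t,-3/2-t,0,-3/2); L96: (-1/2,t,-3/2-t,-1/2,-1/2). -/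

import Mathlib

open MvPolynomial

noncomputable def p1 : MvPolynomial (Fin 5) ℂ :=
    X 0 * X 2 *
      (65 + 10 * X 0 + 12 * X 1 - 8 * X 0 * X 1 - 8 * X 1 ^ 2 + 66 * X 2 + 4 * X 0 * X 2 + 8 * X 1 * X 2 + 16 * X 2 ^ 2 + 112 * X 3 + 16 * X 0 * X 3 + 32 * X 1 * X 3 + 48 * X 2 * X 3 + 32 * X 3 ^ 2 + 40 * X 4 + 8 * X 0 * X 4 + 16 * X 1 * X 4 + 24 * X 2 * X 4 + 32 * X 3 * X 4)

noncomputable def p2 : MvPolynomial (Fin 5) ℂ :=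
    X 0 * X 3 *
      (45 + 10 * X 0 + 28 * X 1 + 8 * X 0 * X 1 + 8 * X 1 ^ 2 + 84 * X 2 + 16 * X 0 * X 2 + 32 * X 1 * X 2 + 24 * X 2 ^ 2 + 38 * X 3 + 4 * X 0 * X 3 + 8 * X 1 * X 3 + 32 * X 2 * X 3 + 8 * X 3 ^ 2 - 8 * X 0 * X 4 - 16 * X 1 * X 4 + 16 * X 2 * X 4 + 8 * X 3 * X 4)

noncomputable def p3 : MvPolynomial (Fin 5) ℂ :=
    X 0 * X 4 *
      (75 + 30 * X 0 + 68 * X 1 + 8 * X 0 * X 1 + 8 * X 1 ^ 2 + 84 * X 2 + 16 * X 0 * X 2 + 32 * X 1 * X 2 + 24 * X 2 ^ 2 + 68 * X 3 + 24 * X 0 * X 3 + 48 * X 1 * X 3 + 32 * X 2 * X 3 + 8 * X 3 ^ 2 + 30 * X 4 + 12 * X 0 * X 4 + 24 * X 1 * X 4 + 16 * X 2 * X 4 + 8 * X 3 * X 4)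

noncomputable def p4 : MvPolynomial (Fin 5) ℂ :=
    X 1 * X 3 *
      (75 + 40 * X 0 + 58 * X 1 + 8 * X 0 * X 1 + 8 * X 1 ^ 2 + 84 * X 2 + 16 * X 0 * X 2 + 32 * X 1 * X 2 + 24 * X 2 ^ 2 + 58 * X 3 + 24 * X 0 * X 3 + 28 * X 1 * X 3 + 32 * X 2 * X 3 + 8 * X 3 ^ 2 + 40 * X 4 + 32 * X 0 * X 4 + 24 * X 1 * X 4 + 16 * X 2 * X 4 + 8 * X 3 * X 4)

noncomputable def p5 : MvPolynomial (Fin 5) ℂ :=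
    X 1 * X 4 *
      (45 + 38 * X 1 + 8 * X 0 * X 1 + 8 * X 1 ^ 2 + 84 * X 2 + 16 * X 0 * X 2 + 32 * X 1 * X 2 + 24 * X 2 ^ 2 + 28 * X 3 - 16 * X 0 * X 3 + 8 * X 1 * X 3 + 32 * X 2 * X 3 + 8 * X 3 ^ 2 + 10 * X 4 - 8 * X 0 * X 4 + 4 * X 1 * X 4 + 16 * X 2 * X 4 + 8 * X 3 * X 4)

noncomputable def p6 : MvPolynomial (Fin 5) ℂ :=
    X 2 * X 4 *
      (65 + 40 * X 0 + 112 * X 1 + 32 * X 0 * X 1 + 32 * X 1 ^ 2 + 66 * X 2 + 24 * X 0 * X 2 + 48 * X 1 * X 2 + 16 * X 2 ^ 2 + 12 * X 3 + 16 * X 0 * X 3 + 32 * X 1 * X 3 + 8 * X 2 * X 3 - 8 * X 3 ^ 2 + 10 * X 4 + 8 * X 0 * X 4 + 16 * X 1 * X 4 + 4 * X 2 * X 4 - 8 * X 3 * X 4)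

noncomputable def p7 : MvPolynomial (Fin 5) ℂ :=
    X 1 * (C (7/2 : ℂ) + X 0 + X 1 + X 2 + X 3 + X 4) *
      (15 + 15 * X 0 + 21 * X 1 + 6 * X 0 * X 1 + 6 * X 1 ^ 2 + 23 * X 2 + 12 * X 0 * X 2 + 14 * X 1 * X 2 + 8 * X 2 ^ 2 + X 3 + 8 * X 0 * X 3 + 6 * X 1 * X 3 + 4 * X 2 * X 3 - 4 * X 3 ^ 2 - 5 * X 4 + 4 * X 0 * X 4 - 2 * X 1 * X 4 - 8 * X 2 * X 4 - 4 * X 3 * X 4)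

noncomputable def p8 : MvPolynomial (Fin 5) ℂ :=
    X 2 * (C (7/2 : ℂ) + X 0 + X 1 + X 2 + X 3 + X 4) *
      (5 - 5 * X 0 + 9 * X 1 + 4 * X 0 * X 1 + 4 * X 1 ^ 2 + 7 * X 2 - 2 * X 0 * X 2 + 6 * X 1 * X 2 + 2 * X 2 ^ 2 + 9 * X 3 - 8 * X 0 * X 3 + 4 * X 1 * X 3 + 6 * X 2 * X 3 + 4 * X 3 ^ 2 - 5 * X 4 - 4 * X 0 * X 4 - 8 * X 1 * X 4 - 2 * X 2 * X 4 + 4 * X 3 * X 4)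

noncomputable def p9 : MvPolynomial (Fin 5) ℂ :=
    X 3 * (C (7/2 : ℂ) + X 0 + X 1 + X 2 + X 3 + X 4) *
      (15 - 5 * X 0 + X 1 - 4 * X 0 * X 1 - 4 * X 1 ^ 2 + 23 * X 2 - 8 * X 0 * X 2 + 4 * X 1 * X 2 + 8 * X 2 ^ 2 + 21 * X 3 - 2 * X 0 * X 3 + 6 * X 1 * X 3 + 14 * X 2 * X 3 + 6 * X 3 ^ 2 + 15 * X 4 + 4 * X 0 * X 4 + 8 * X 1 * X 4 + 12 * X 2 * X 4 + 6 * X 3 * X 4)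

noncomputable def p : Fin 9 → MvPolynomial (Fin 5) ℂ := ![p1, p2, p3, p4, p5, p6, p7, p8, p9]

/-- `Good a b c d e` says that the point with these coordinates lies on one of the 96 lines; the
constructor `lk` is the k-th line of the classification. Writing it as an inductive predicate lets a
leaf of the case analysis below name its line together with the parameter value. -/
inductive Good : ℂ → ℂ → ℂ → ℂ → ℂ → Prop
  | l1 t : Good t 0 0 0 0
  | l2 t : Good 0 0 0 0 t
  | l3 t : Good t (-t-7/2) 0 0 0
  | l4 t : Good 0 t (-t-7/2) 0 0
  | l5 t : Good 0 0 t (-t-7/2) 0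
  | l6 t : Good 0 0 0 t (-t-7/2)
  | l7 t : Good t (-t-1) 0 0 0
  | l8 t : Good 0 t (-t-1) 0 0
  | l9 t : Good 0 0 t (-t-1) 0
  | l10 t : Good 0 0 0 t (-t-1)
  | l11 t : Good t (-5/2) 0 0 0
  | l12 t : Good t 0 (-5/2) 0 0
  | l13 t : Good t 0 0 (-5/2) 0
  | l14 t : Good t 0 0 0 (-5/2)
  | l15 t : Good (-5/2) 0 0 0 t
  | l16 t : Good 0 (-5/2) 0 0 t
  | l17 t : Good 0 0 (-5/2) 0 t
  | l18 t : Good 0 0 0 (-5/2) t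
  | l19 t : Good (-5/2) t (-1-t) 0 0
  | l20 t : Good (-5/2) 0 t (-1-t) 0
  | l21 t : Good (-5/2) 0 0 t (-1-t)
  | l22 t : Good (1/2) t (-5/2-t) 0 0
  | l23 t : Good (-1/2) 0 t (-5/2-t) 0
  | l24 t : Good (-3/2) 0 0 t (-5/2-t)
  | l25 t : Good 0 (-5/2) t (-1-t) 0
  | l26 t : Good 0 (-5/2) 0 t (-1-t)
  | l27 t : Good 0 (-1/2) t (-3/2-t) 0
  | l28 t : Good 0 (-3/2) 0 t (-3/2-t)
  | l29 t : Good 0 0 (-5/2) t (-1-t)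
  | l30 t : Good 0 0 (-3/2) t (-1/2-t)
  | l31 t : Good t (-1-t) 0 0 (-5/2)
  | l32 t : Good 0 t (-1-t) 0 (-5/2)
  | l33 t : Good 0 0 t (-1-t) (-5/2)
  | l34 t : Good t (-5/2-t) 0 0 (-3/2)
  | l35 t : Good 0 t (-5/2-t) 0 (-1/2)
  | l36 t : Good 0 0 t (-5/2-t) (1/2)
  | l37 t : Good t (-1-t) 0 (-5/2) 0
  | l38 t : Good 0 t (-1-t) (-5/2) 0
  | l39 t : Good t (-3/2-t) 0 (-3/2) 0
  | l40 t : Good 0 t (-3/2-t) (-1/2) 0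
  | l41 t : Good t (-1-t) (-5/2) 0 0
  | l42 t : Good t (-1/2-t) (-3/2) 0 0
  | l43 t : Good t (1/2) (-3/2) 0 0
  | l44 t : Good t (-1/2) 0 (-3/2) 0
  | l45 t : Good t (-3/2) 0 0 (-3/2)
  | l46 t : Good t 0 (-1/2) (-1/2) 0
  | l47 t : Good t 0 (-3/2) 0 (-1/2)
  | l48 t : Good t 0 0 (-3/2) (1/2)
  | l49 t : Good (1/2) (-3/2) 0 0 t
  | l50 t : Good (-1/2) 0 (-3/2) 0 t
  | l51 t : Good (-3/2) 0 0 (-3/2) t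
  | l52 t : Good 0 (-1/2) (-1/2) 0 t
  | l53 t : Good 0 (-3/2) 0 (-1/2) t
  | l54 t : Good 0 0 (-3/2) (1/2) t
  | l55 t : Good t (-3/2) (1/2) (-3/2) 0
  | l56 t : Good t (-1/2) (-1/2) 0 (-3/2)
  | l57 t : Good t (-3/2) 0 (-1/2) (-1/2)
  | l58 t : Good t 0 (-3/2) (1/2) (-3/2)
  | l59 t : Good (-3/2) (1/2) (-3/2) 0 t
  | l60 t : Good (-1/2) (-1/2) 0 (-3/2) t
  | l61 t : Good (-3/2) 0 (-1/2) (-1/2) t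
  | l62 t : Good 0 (-3/2) (1/2) (-3/2) t
  | l63 t : Good t (-5/2-t) (1/2) (-3/2) 0
  | l64 t : Good t (-3/2-t) (-1/2) 0 (-3/2)
  | l65 t : Good t (-5/2-t) 0 (-1/2) (-1/2)
  | l66 t : Good t (-1-t) (-1/2) (-1/2) 0
  | l67 t : Good t (-1-t) (-3/2) 0 (-1/2)
  | l68 t : Good t (-1-t) 0 (-3/2) (1/2)
  | l69 t : Good 0 t (-5/2-t) (1/2) (-3/2)
  | l70 t : Good 0 t (-1-t) (-3/2) (1/2)
  | l71 t : Good (-3/2) (1/2) t (-5/2-t) 0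
  | l72 t : Good (-1/2) (-1/2) 0 t (-5/2-t)
  | l73 t : Good (-3/2) 0 (-1/2) t (-3/2-t)
  | l74 t : Good 0 (-3/2) (1/2) t (-5/2-t)
  | l75 t : Good (1/2) (-3/2) 0 t (-1-t)
  | l76 t : Good (-1/2) 0 (-3/2) t (-1-t)
  | l77 t : Good 0 (-1/2) (-1/2) t (-1-t)
  | l78 t : Good (1/2) (-3/2) t (-1-t) 0
  | l79 t : Good t (-1/2) (-1/2) (-1/2) (-1/2)
  | l80 t : Good (-1/2) (-1/2) (-1/2) (-1/2) t
  | l81 t : Good t (-1-t) (-3/2) (1/2) (-3/2)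
  | l82 t : Good t (-3/2-t) (-1/2) (-1/2) (-1/2)
  | l83 t : Good (-3/2) (1/2) (-3/2) t (-1-t)
  | l84 t : Good (-1/2) (-1/2) (-1/2) t (-3/2-t)
  | l85 t : Good 0 (-3/2) t (-1-t) (-1/2)
  | l86 t : Good (-3/2) 0 t (-1-t) (-3/2)
  | l87 t : Good 0 (-3/2) t (-1/2-t) (-3/2)
  | l88 t : Good (-1/2) (-1/2) t (-1-t) (-3/2)
  | l89 t : Good (-3/2) 0 t (-3/2-t) (-1/2)
  | l90 t : Good (-1/2) (-1/2) t (-3/2-t) (-1/2)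
  | l91 t : Good (-1/2) t (-1-t) (-3/2) 0
  | l92 t : Good (-3/2) t (-1-t) 0 (-3/2)
  | l93 t : Good (-3/2) t (-1/2-t) (-3/2) 0
  | l94 t : Good (-3/2) t (-1-t) (-1/2) (-1/2)
  | l95 t : Good (-1/2) t (-3/2-t) 0 (-3/2)
  | l96 t : Good (-1/2) t (-3/2-t) (-1/2) (-1/2)

open Good

theorem Good.k {a b c d e a1 b1 c1 d1 e1 : ℂ} (h : Good a b c d e) (ha : a = a1 := by ring)
    (hb : b = b1 := by ring) (hc : c = c1 := by ring) (hd : d = d1 := by ring)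
    (he : e = e1 := by ring) : Good a1 b1 c1 d1 e1 := by
  subst ha hb hc hd he; exact h

theorem no {G : Prop} (h : (1 : ℂ) = 0) : G := (one_ne_zero h).elim

theorem n2 {G : Prop} {x y : ℂ} (hx : x ≠ 0) (hy : y ≠ 0) (h : x * y = 0) : G :=
  (mul_ne_zero hx hy h).elim

theorem s1 {x y z : ℂ} (n : z ≠ 0) (h : (x - y) * z = 0) : x = y :=
  sub_eq_zero.1 ((mul_eq_zero.1 h).resolve_right n)

theorem s2 {x y : ℂ} (h : (x - y) * (x - y) = 0) : x = y :=
  sub_eq_zero.1 (mul_self_eq_zero.1 h)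

theorem s3 {x y z w : ℂ} (h : (x - y) * (z - w) = 0) : x = y ∨ z = w :=
  (mul_eq_zero.1 h).imp sub_eq_zero.1 sub_eq_zero.1

theorem r3 {x y z : ℂ} (h : x * y * z = 0) (hx : x ≠ 0) (hy : y ≠ 0) : z = 0 :=
  (mul_eq_zero.1 h).resolve_left (mul_ne_zero hx hy)

/-! The quadratic cofactors of the nine polynomials. Several pencils spanned by them contain
reducible members, for instance q3 - q2 = 10 (3 + 2a + 4b)(1 + d + e) and
q4 - q2 = 10 (1 + a + b)(3 + 2d + 4e). The whole argument rests on this: once we know which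
coordinates vanish, some linear combination of the surviving quadrics splits into two affine
factors, either factor eliminates one coordinate, and after finitely many such eliminations we reach
a listed line, a point of a listed line, or a contradiction. -/

def q1 (a b c d e : ℂ) : ℂ :=
  65 + 10*a + 12*b - 8*a*b - 8*b^2 + 66*c + 4*a*c + 8*b*c + 16*c^2 + 112*d + 16*a*d + 32*b*d + 48*c*d + 32*d^2 + 40*e + 8*a*e + 16*b*e + 24*c*e + 32*d*e

def q2 (a b c d e : ℂ) : ℂ :=
  45 + 10*a + 28*b + 8*a*b + 8*b^2 + 84*c + 16*a*c + 32*b*c + 24*c^2 + 38*d + 4*a*d + 8*b*d + 32*c*d + 8*d^2 - 8*a*e - 16*b*e + 16*c*e + 8*d*e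

def q3 (a b c d e : ℂ) : ℂ :=
  75 + 30*a + 68*b + 8*a*b + 8*b^2 + 84*c + 16*a*c + 32*b*c + 24*c^2 + 68*d + 24*a*d + 48*b*d + 32*c*d + 8*d^2 + 30*e + 12*a*e + 24*b*e + 16*c*e + 8*d*e

def q4 (a b c d e : ℂ) : ℂ :=
  75 + 40*a + 58*b + 8*a*b + 8*b^2 + 84*c + 16*a*c + 32*b*c + 24*c^2 + 58*d + 24*a*d + 28*b*d + 32*c*d + 8*d^2 + 40*e + 32*a*e + 24*b*e + 16*c*e + 8*d*e

def q5 (a b c d e : ℂ) : ℂ :=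
  45 + 38*b + 8*a*b + 8*b^2 + 84*c + 16*a*c + 32*b*c + 24*c^2 + 28*d - 16*a*d + 8*b*d + 32*c*d + 8*d^2 + 10*e - 8*a*e + 4*b*e + 16*c*e + 8*d*e

def q6 (a b c d e : ℂ) : ℂ :=
  65 + 40*a + 112*b + 32*a*b + 32*b^2 + 66*c + 24*a*c + 48*b*c + 16*c^2 + 12*d + 16*a*d + 32*b*d + 8*c*d - 8*d^2 + 10*e + 8*a*e + 16*b*e + 4*c*e - 8*d*e

def q7 (a b c d e : ℂ) : ℂ :=
  15 + 15*a + 21*b + 6*a*b + 6*b^2 + 23*c + 12*a*c + 14*b*c + 8*c^2 + d + 8*a*d + 6*b*d + 4*c*d - 4*d^2 - 5*e + 4*a*e - 2*b*e - 8*c*e - 4*d*e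

def q8 (a b c d e : ℂ) : ℂ :=
  5 - 5*a + 9*b + 4*a*b + 4*b^2 + 7*c - 2*a*c + 6*b*c + 2*c^2 + 9*d - 8*a*d + 4*b*d + 6*c*d + 4*d^2 - 5*e - 4*a*e - 8*b*e - 2*c*e + 4*d*e

def q9 (a b c d e : ℂ) : ℂ :=
  15 - 5*a + b - 4*a*b - 4*b^2 + 23*c - 8*a*c + 4*b*c + 8*c^2 + 21*d - 2*a*d + 6*b*d + 14*c*d + 6*d^2 + 15*e + 4*a*e + 8*b*e + 12*c*e + 6*d*e

set_option maxHeartbeats 4000000 in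
/-- Case in which the affine factor 7/2 + a + b + c + d + e vanishes: only the first six quadrics
are available, but one coordinate is determined by the others. -/
theorem coreZ (a b c d e : ℂ) (hs : 7/2 + a + b + c + d + e = 0)
    (h1 : a * c * q1 a b c d e = 0)
    (h2 : a * d * q2 a b c d e = 0)
    (h3 : a * e * q3 a b c d e = 0)
    (h4 : b * d * q4 a b c d e = 0)
    (h5 : b * e * q5 a b c d e = 0)
    (h6 : c * e * q6 a b c d e = 0)
    : Good a b c d e := by
  simp only [q1, q2, q3, q4, q5, q6] at h1 h2 h3 h4 h5 h6
  obtain rfl | n0 := eq_or_ne a 0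
  · obtain rfl | n1 := eq_or_ne b 0
    · obtain rfl | n2 := eq_or_ne c 0
      · obtain rfl | n3 := eq_or_ne d 0
        · obtain rfl | n4 := eq_or_ne e 0
          · exact l1 0
          obtain rfl : e = -7/2 := by linear_combination hs
          exact (l2 (-7/2)).k
        obtain rfl | n4 := eq_or_ne e 0
        · obtain rfl : d = -7/2 := by linear_combination hs
          exact (l5 0).k
        obtain rfl : e = -d - 7/2 := by linear_combination hs
        exact (l6 d).k
      obtain rfl | n3 := eq_or_ne d 0
      · obtain rfl | n4 := eq_or_ne e 0
        · obtain rfl : c = -7/2 := by linear_combination hs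
          exact (l4 0).k
        replace h6 := r3 h6 n2 n4
        obtain rfl : e = -c - 7/2 := by linear_combination hs
        obtain rfl | rfl : c = -1 ∨ c = -5/2 := s3 (by linear_combination 1/12*h6)
        · exact (l32 0).k
        exact (l17 (-1)).k
      obtain rfl | n4 := eq_or_ne e 0
      · obtain rfl : d = -c - 7/2 := by linear_combination hs
        exact (l5 c).k
      replace h6 := r3 h6 n2 n4
      obtain rfl : e = -c - d - 7/2 := by linear_combination hs
      obtain rfl | rfl : c = -5/2 ∨ d = -c - 1 := s3 (by linear_combination 1/12*h6)
      · exact (l29 d).k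
      exact (l33 c).k
    obtain rfl | n2 := eq_or_ne c 0
    · obtain rfl | n3 := eq_or_ne d 0
      · obtain rfl | n4 := eq_or_ne e 0
        · obtain rfl : b = -7/2 := by linear_combination hs
          exact (l3 0).k
        replace h5 := r3 h5 n1 n4
        obtain rfl : e = -b - 7/2 := by linear_combination hs
        obtain rfl | rfl : b = -1 ∨ b = -5/2 := s3 (by linear_combination 1/4*h5)
        · exact (l31 0).k
        exact (l16 (-1)).k
      replace h4 := r3 h4 n1 n3
      obtain rfl | n4 := eq_or_ne e 0
      · obtain rfl : d = -b - 7/2 := by linear_combination hs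
        obtain rfl | rfl : b = -1 ∨ b = -5/2 := s3 (by linear_combination -1/12*h4)
        · exact (l37 0).k
        exact (l25 0).k
      replace h5 := r3 h5 n1 n4
      obtain rfl : e = -b - d - 7/2 := by linear_combination hs
      obtain rfl | rfl : b = -3/2 ∨ b = -5/2 := s3 (by linear_combination -1/20*h4 + 1/20*h5)
      · obtain rfl : d = -1/2 := by linear_combination -1/4*h4
        exact (l53 (-3/2)).k
      exact (l26 d).k
    obtain rfl | n3 := eq_or_ne d 0
    · obtain rfl | n4 := eq_or_ne e 0
      · obtain rfl : c = -b - 7/2 := by linear_combination hs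
        exact (l4 b).k
      replace h5 := r3 h5 n1 n4
      replace h6 := r3 h6 n2 n4
      obtain rfl : e = -b - c - 7/2 := by linear_combination hs
      obtain rfl | rfl : c = -1/2 ∨ c = -b - 1 := s3 (by linear_combination 1/5*h5 - 1/20*h6)
      · obtain rfl | rfl : b = -1/2 ∨ b = -3/2 := s3 (by linear_combination 1/4*h5)
        · exact (l32 (-1/2)).k
        exact (l64 0).k
      exact (l32 b).k
    replace h4 := r3 h4 n1 n3
    obtain rfl | n4 := eq_or_ne e 0
    · obtain rfl : d = -b - c - 7/2 := by linear_combination hs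
      obtain rfl | rfl : b = -5/2 ∨ c = -b - 1 := s3 (by linear_combination -1/12*h4)
      · exact (l25 c).k
      exact (l38 b).k
    replace h5 := r3 h5 n1 n4
    replace h6 := r3 h6 n2 n4
    obtain rfl : e = -b - c - d - 7/2 := by linear_combination hs
    obtain rfl | rfl : b = -3/2 ∨ c = -b - 5/2 := s3 (by linear_combination -1/20*h4 + 1/20*h5)
    · obtain rfl | rfl : c = 1/2 ∨ d = -c - 1/2 := s3 (by linear_combination 1/8*h4)
      · exact (l74 d).k
      exact (l87 c).k
    obtain rfl : d = 1/2 := s1 n1 (by linear_combination 1/12*h6)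
    exact (l69 b).k
  obtain rfl | n1 := eq_or_ne b 0
  · obtain rfl | n2 := eq_or_ne c 0
    · obtain rfl | n3 := eq_or_ne d 0
      · obtain rfl | n4 := eq_or_ne e 0
        · obtain rfl : a = -7/2 := by linear_combination hs
          exact (l1 (-7/2)).k
        replace h3 := r3 h3 n0 n4
        obtain rfl : e = -a - 7/2 := by linear_combination hs
        obtain rfl | rfl : a = -1 ∨ a = -5/2 := s3 (by linear_combination -1/12*h3)
        · exact (l14 (-1)).k
        exact (l15 (-1)).k
      replace h2 := r3 h2 n0 n3
      obtain rfl | n4 := eq_or_ne e 0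
      · obtain rfl : d = -a - 7/2 := by linear_combination hs
        obtain rfl | rfl : a = -1 ∨ a = -5/2 := s3 (by linear_combination 1/4*h2)
        · exact (l13 (-1)).k
        exact (l20 0).k
      replace h3 := r3 h3 n0 n4
      obtain rfl : e = -a - d - 7/2 := by linear_combination hs
      obtain rfl | rfl : a = -3/2 ∨ a = -5/2 := s3 (by linear_combination 1/20*h2 - 1/20*h3)
      · obtain rfl : d = -3/2 := by linear_combination 1/4*h2
        exact (l51 (-1/2)).k
      exact (l21 d).k
    replace h1 := r3 h1 n0 n2
    obtain rfl | n3 := eq_or_ne d 0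
    · obtain rfl | n4 := eq_or_ne e 0
      · obtain rfl : c = -a - 7/2 := by linear_combination hs
        obtain rfl | rfl : a = -1 ∨ a = -5/2 := s3 (by linear_combination 1/12*h1)
        · exact (l12 (-1)).k
        exact (l19 0).k
      replace h3 := r3 h3 n0 n4
      replace h6 := r3 h6 n2 n4
      obtain rfl : e = -a - c - 7/2 := by linear_combination hs
      obtain rfl | rfl : c = -1/2 ∨ c = -3/2 := s3 (by linear_combination -3/20*h1 + 1/5*h3 - 3/20*h6)
      · obtain rfl : a = -3/2 := s1 n0 (by linear_combination 3/40*h1 - 2/15*h3)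
        exact (l64 (-3/2)).k
      obtain rfl | rfl : a = -1/2 ∨ a = -3/2 := s3 (by linear_combination -1/8*h1)
      · exact (l50 (-3/2)).k
      exact (l47 (-3/2)).k
    replace h2 := r3 h2 n0 n3
    obtain rfl | n4 := eq_or_ne e 0
    · obtain rfl : d = -a - c - 7/2 := by linear_combination hs
      obtain rfl | rfl : a = -3/2 ∨ a = -5/2 := s3 (by linear_combination 1/20*h1 + 1/20*h2)
      · obtain rfl : c = -1/2 := by linear_combination 1/4*h1
        exact (l73 (-3/2)).k
      exact (l20 c).k
    replace h3 := r3 h3 n0 n4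
    replace h6 := r3 h6 n2 n4
    obtain rfl : e = -a - c - d - 7/2 := by linear_combination hs
    obtain rfl | rfl : c = -3/2 ∨ a = -3/2 := s3 (by linear_combination 1/20*h1 - 1/10*h3 + 1/10*h6)
    · obtain rfl : a = -1 := s1 n3 (by linear_combination -3/80*h1 + 1/40*h3)
      obtain rfl : d = 1/2 := by linear_combination -1/4*h1
      exact (l58 (-1)).k
    obtain rfl | rfl : c = -1/2 ∨ d = -c - 3/2 := s3 (by linear_combination -1/8*h1)
    · exact (l73 d).k
    exact (l89 c).k
  obtain rfl | n2 := eq_or_ne c 0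
  · obtain rfl | n3 := eq_or_ne d 0
    · obtain rfl | n4 := eq_or_ne e 0
      · obtain rfl : b = -a - 7/2 := by linear_combination hs
        exact (l3 a).k
      replace h3 := r3 h3 n0 n4
      replace h5 := r3 h5 n1 n4
      obtain rfl : e = -a - b - 7/2 := by linear_combination hs
      obtain rfl | rfl : a = -1/2 ∨ b = -a - 1 := s3 (by linear_combination 1/20*h3 + 1/5*h5)
      · obtain rfl | rfl : b = -1/2 ∨ b = -3/2 := s3 (by linear_combination -1/16*h3)
        · exact (l31 (-1/2)).k
        exact (l45 (-1/2)).k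
      exact (l31 a).k
    replace h2 := r3 h2 n0 n3
    replace h4 := r3 h4 n1 n3
    obtain rfl | n4 := eq_or_ne e 0
    · obtain rfl : d = -a - b - 7/2 := by linear_combination hs
      obtain rfl | rfl : b = -1/2 ∨ b = -a - 1 := s3 (by linear_combination 1/5*h2 + 1/20*h4)
      · obtain rfl | rfl : a = -1/2 ∨ a = -3/2 := s3 (by linear_combination 1/4*h2)
        · exact (l37 (-1/2)).k
        exact (l44 (-3/2)).k
      exact (l37 a).k
    replace h3 := r3 h3 n0 n4
    replace h5 := r3 h5 n1 n4
    obtain rfl : e = -a - b - d - 7/2 := by linear_combination hs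
    obtain rfl | rfl : b = -1/2 ∨ d = -4/3*a - 4/3*b - 23/6 := s3 (by linear_combination 1/15*h2 + 1/60*h4)
    · obtain rfl | rfl : a = -2 ∨ a = -1/2 := s3 (by linear_combination 1/20*h2 - 1/20*h3)
      · obtain rfl : d = -1/2 := by linear_combination -1/6*h2
        exact (l65 (-2)).k
      exact (l72 d).k
    obtain rfl : b = -a - 5/2 := s1 n4 (by linear_combination 1/8*h2)
    exact (l65 a).k
  replace h1 := r3 h1 n0 n2
  obtain rfl | n3 := eq_or_ne d 0
  · obtain rfl | n4 := eq_or_ne e 0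
    · obtain rfl : c = -a - b - 7/2 := by linear_combination hs
      obtain rfl | rfl : a = -5/2 ∨ b = -a - 1 := s3 (by linear_combination 1/12*h1)
      · exact (l19 b).k
      exact (l41 a).k
    replace h3 := r3 h3 n0 n4
    replace h5 := r3 h5 n1 n4
    replace h6 := r3 h6 n2 n4
    obtain rfl : e = -a - b - c - 7/2 := by linear_combination hs
    obtain rfl | rfl : c = -1/2 ∨ a = -2*b - 2*c - 7/2 := s3 (by linear_combination -1/20*h1 + 1/10*h3 + 1/10*h5)
    · obtain rfl : b = -a - 3/2 := s1 n1 (by linear_combination 3/40*h1 - 1/10*h3 + 3/40*h6)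
      exact (l64 a).k
    obtain rfl | rfl : c = -3/2 ∨ c = -b - 3/2 := s3 (by linear_combination 1/5*h1 + 1/20*h6)
    · obtain rfl : b = 1/2 := s1 n1 (by linear_combination 1/8*h1)
      exact (l59 (-1)).k
    exact (l95 b).k
  replace h2 := r3 h2 n0 n3
  replace h4 := r3 h4 n1 n3
  obtain rfl | n4 := eq_or_ne e 0
  · obtain rfl : d = -a - b - c - 7/2 := by linear_combination hs
    obtain rfl | rfl : a = -3/2 ∨ b = -a - 5/2 := s3 (by linear_combination 1/20*h1 + 1/20*h2)
    · obtain rfl | rfl : b = 1/2 ∨ c = -b - 1/2 := s3 (by linear_combination -1/8*h1)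
      · exact (l71 c).k
      exact (l93 b).k
    obtain rfl : c = 1/2 := s1 n0 (by linear_combination -1/12*h4)
    exact (l63 a).k
  replace h3 := r3 h3 n0 n4
  replace h5 := r3 h5 n1 n4
  replace h6 := r3 h6 n2 n4
  obtain rfl : e = -a - b - c - d - 7/2 := by linear_combination hs
  obtain rfl | rfl : b = -a - 1 ∨ a = -3/2 := s3 (by linear_combination -1/20*h1 + 1/20*h2 + 1/20*h3 - 1/10*h6)
  · obtain rfl | rfl : a = -1/2 ∨ c = -3/2 := s3 (by linear_combination -1/20*h2 + 1/20*h3)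
    · obtain rfl : d = -c - 1 := s1 n2 (by linear_combination 1/8*h2)
      exact (l88 c).k
    obtain rfl | rfl : d = 1/2 ∨ a = -3/2 := s3 (by linear_combination -1/8*h1)
    · exact (l81 a).k
    exact (l83 d).k
  obtain rfl : c = -b - 1 := s1 n1 (by linear_combination -1/40*h1 - 1/40*h3)
  obtain rfl | rfl : d = -1/2 ∨ b = 1/2 := s3 (by linear_combination -1/8*h1)
  · exact (l94 b).k
  exact (l83 d).k

set_option maxHeartbeats 4000000 in
/-- Case in which the common affine factor is invertible, so that all nine cofactors may be used for
those coordinates which are different from zero. -/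
theorem coreU (a b c d e : ℂ) (ns : 7/2 + a + b + c + d + e ≠ 0)
    (h1 : a * c * q1 a b c d e = 0)
    (h2 : a * d * q2 a b c d e = 0)
    (h3 : a * e * q3 a b c d e = 0)
    (h4 : b * d * q4 a b c d e = 0)
    (h5 : b * e * q5 a b c d e = 0)
    (h6 : c * e * q6 a b c d e = 0)
    (h7 : b * (7/2 + a + b + c + d + e) * q7 a b c d e = 0)
    (h8 : c * (7/2 + a + b + c + d + e) * q8 a b c d e = 0)
    (h9 : d * (7/2 + a + b + c + d + e) * q9 a b c d e = 0)
    : Good a b c d e := by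
  simp only [q1, q2, q3, q4, q5, q6, q7, q8, q9] at h1 h2 h3 h4 h5 h6 h7 h8 h9
  obtain rfl | n0 := eq_or_ne a 0
  · obtain rfl | n1 := eq_or_ne b 0
    · obtain rfl | n2 := eq_or_ne c 0
      · obtain rfl | n3 := eq_or_ne d 0
        · obtain rfl | n4 := eq_or_ne e 0
          · exact (l1 0).k
          exact (l2 e).k
        replace h9 := r3 h9 n3 ns
        obtain rfl | n4 := eq_or_ne e 0
        · obtain rfl | rfl : d = -1 ∨ d = -5/2 := s3 (by linear_combination 1/6*h9)
          · exact (l9 0).k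
          exact (l13 0).k
        obtain rfl | rfl : d = -5/2 ∨ e = -d - 1 := s3 (by linear_combination 1/6*h9)
        · exact (l18 e).k
        exact (l10 d).k
      replace h8 := r3 h8 n2 ns
      obtain rfl | n3 := eq_or_ne d 0
      · obtain rfl | n4 := eq_or_ne e 0
        · obtain rfl | rfl : c = -1 ∨ c = -5/2 := s3 (by linear_combination 1/2*h8)
          · exact (l8 0).k
          exact (l12 0).k
        replace h6 := r3 h6 n2 n4
        obtain rfl | rfl : c = -3/2 ∨ c = -5/2 := s3 (by linear_combination 1/20*h6 + 1/10*h8)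
        · obtain rfl : e = -1/2 := by linear_combination 1/4*h6
          exact (l30 0).k
        exact (l17 e).k
      replace h9 := r3 h9 n3 ns
      obtain rfl | n4 := eq_or_ne e 0
      · obtain rfl | rfl : d = -1/2 ∨ d = -c - 1 := s3 (by linear_combination 2/5*h8 - 1/10*h9)
        · obtain rfl | rfl : c = -1/2 ∨ c = -3/2 := s3 (by linear_combination 1/2*h8)
          · exact (l9 (-1/2)).k
          exact (l30 (-1/2)).k
        exact (l9 c).k
      replace h6 := r3 h6 n2 n4
      obtain rfl | rfl : c = -3/2 ∨ d = -c - 5/2 := s3 (by linear_combination 1/20*h6 + 1/10*h8)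
      · obtain rfl | rfl : d = 1/2 ∨ e = -d - 1/2 := s3 (by linear_combination -1/8*h6)
        · exact (l54 e).k
        exact (l30 d).k
      obtain rfl : e = 1/2 := s1 n2 (by linear_combination 1/6*h9)
      exact (l36 c).k
    replace h7 := r3 h7 n1 ns
    obtain rfl | n2 := eq_or_ne c 0
    · obtain rfl | n3 := eq_or_ne d 0
      · obtain rfl | n4 := eq_or_ne e 0
        · obtain rfl | rfl : b = -1 ∨ b = -5/2 := s3 (by linear_combination 1/6*h7)
          · exact (l7 0).k
          exact (l11 0).k
        replace h5 := r3 h5 n1 n4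
        obtain rfl | rfl : b = -3/2 ∨ b = -5/2 := s3 (by linear_combination 1/20*h5 + 1/10*h7)
        · obtain rfl : e = -3/2 := by linear_combination 1/4*h5
          exact (l28 0).k
        exact (l16 e).k
      replace h4 := r3 h4 n1 n3
      replace h9 := r3 h9 n3 ns
      obtain rfl | n4 := eq_or_ne e 0
      · obtain rfl | rfl : d = -1/2 ∨ d = -3/2 := s3 (by linear_combination 3/20*h4 - 2/5*h7 - 3/10*h9)
        · obtain rfl : b = -3/2 := s1 n1 (by linear_combination -3/40*h4 + 4/15*h7)
          exact (l40 (-3/2)).k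
        obtain rfl | rfl : b = -1/2 ∨ b = -3/2 := s3 (by linear_combination 1/8*h4)
        · exact (l27 0).k
        exact (l28 (-3/2)).k
      replace h5 := r3 h5 n1 n4
      obtain rfl | rfl : d = -3/2 ∨ b = -3/2 := s3 (by linear_combination -1/20*h4 + 1/5*h7 + 1/5*h9)
      · obtain rfl : b = -1 := s1 n4 (by linear_combination 3/80*h4 - 1/20*h7)
        obtain rfl : e = 1/2 := by linear_combination 1/4*h4
        exact (l68 0).k
      obtain rfl | rfl : d = -1/2 ∨ e = -d - 3/2 := s3 (by linear_combination 1/8*h4)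
      · exact (l53 e).k
      exact (l28 d).k
    replace h8 := r3 h8 n2 ns
    obtain rfl | n3 := eq_or_ne d 0
    · obtain rfl | n4 := eq_or_ne e 0
      · obtain rfl | rfl : b = -1/2 ∨ c = -b - 1 := s3 (by linear_combination -1/10*h7 + 2/5*h8)
        · obtain rfl | rfl : c = -1/2 ∨ c = -3/2 := s3 (by linear_combination 1/8*h7)
          · exact (l8 (-1/2)).k
          exact (l27 (-3/2)).k
        exact (l8 b).k
      replace h5 := r3 h5 n1 n4
      replace h6 := r3 h6 n2 n4
      obtain rfl | rfl : c = -1/2 ∨ e = -4/3*b - 4/3*c - 23/6 := s3 (by linear_combination 1/15*h5 - 1/60*h6)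
      · obtain rfl | rfl : b = -2 ∨ b = -1/2 := s3 (by linear_combination 1/20*h5 + 1/10*h7)
        · obtain rfl : e = -1/2 := by linear_combination -1/6*h5
          exact (l35 (-2)).k
        exact (l52 e).k
      obtain rfl : c = -b - 5/2 := s1 ns (by linear_combination -1/8*h5)
      exact (l35 b).k
    replace h4 := r3 h4 n1 n3
    replace h9 := r3 h9 n3 ns
    obtain rfl | n4 := eq_or_ne e 0
    · obtain rfl | rfl : d = -1/2 ∨ b = -2*c - 2*d - 7/2 := s3 (by linear_combination 1/20*h4 - 1/5*h7 + 1/5*h8)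
      · obtain rfl : c = -b - 3/2 := s1 n2 (by linear_combination -3/40*h4 + 1/5*h7 + 3/20*h9)
        exact (l40 b).k
      obtain rfl | rfl : d = -3/2 ∨ d = -c - 3/2 := s3 (by linear_combination -1/5*h4 + 1/10*h9)
      · obtain rfl : c = 1/2 := s1 n2 (by linear_combination -1/8*h4)
        exact (l55 0).k
      exact (l27 c).k
    replace h5 := r3 h5 n1 n4
    replace h6 := r3 h6 n2 n4
    obtain rfl | rfl : c = -b - 1 ∨ b = -3/2 := s3 (by linear_combination 1/20*h4 + 1/20*h5 - 1/10*h7 - 1/5*h9)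
    · obtain rfl | rfl : b = -1/2 ∨ d = -3/2 := s3 (by linear_combination -1/20*h5 - 1/10*h7)
      · obtain rfl : e = -d - 1 := s1 n3 (by linear_combination 1/8*h5)
        exact (l77 d).k
      obtain rfl | rfl : e = 1/2 ∨ b = -3/2 := s3 (by linear_combination 1/8*h4)
      · exact (l70 b).k
      exact (l62 e).k
    obtain rfl : d = -c - 1 := s1 n2 (by linear_combination 1/40*h4 + 1/20*h7)
    obtain rfl | rfl : e = -1/2 ∨ c = 1/2 := s3 (by linear_combination 1/8*h4)
    · exact (l85 c).k
    exact (l62 e).k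
  obtain rfl | n1 := eq_or_ne b 0
  · obtain rfl | n2 := eq_or_ne c 0
    · obtain rfl | n3 := eq_or_ne d 0
      · obtain rfl | n4 := eq_or_ne e 0
        · exact (l1 a).k
        replace h3 := r3 h3 n0 n4
        obtain rfl | rfl : e = -5/2 ∨ a = -5/2 := s3 (by linear_combination 1/12*h3)
        · exact (l14 a).k
        exact (l15 e).k
      replace h2 := r3 h2 n0 n3
      replace h9 := r3 h9 n3 ns
      obtain rfl | n4 := eq_or_ne e 0
      · obtain rfl | rfl : d = -3/2 ∨ d = -5/2 := s3 (by linear_combination 1/20*h2 + 1/10*h9)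
        · obtain rfl : a = -3/2 := by linear_combination 1/4*h2
          exact (l39 (-3/2)).k
        exact (l13 a).k
      replace h3 := r3 h3 n0 n4
      obtain rfl | rfl : d = -3/2 ∨ e = -d - 5/2 := s3 (by linear_combination 1/20*h2 + 1/10*h9)
      · obtain rfl | rfl : e = 1/2 ∨ a = -3/2 := s3 (by linear_combination -1/8*h2)
        · exact (l48 a).k
        exact (l51 e).k
      obtain rfl : a = -3/2 := s1 n3 (by linear_combination 1/12*h3)
      exact (l24 d).k
    replace h1 := r3 h1 n0 n2
    replace h8 := r3 h8 n2 ns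
    obtain rfl | n3 := eq_or_ne d 0
    · obtain rfl | n4 := eq_or_ne e 0
      · obtain rfl | rfl : c = -3/2 ∨ c = -5/2 := s3 (by linear_combination 1/20*h1 + 1/10*h8)
        · obtain rfl : a = -1/2 := by linear_combination 1/4*h1
          exact (l42 (-1/2)).k
        exact (l12 a).k
      replace h3 := r3 h3 n0 n4
      replace h6 := r3 h6 n2 n4
      obtain rfl | rfl : e = -3/2 ∨ c = -3/2 := s3 (by linear_combination 1/10*h1 - 1/10*h3 + 1/20*h6)
      · obtain rfl : a = -2*c - 7/2 := s1 n2 (by linear_combination 1/10*h1 + 1/40*h3 - 1/10*h8)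
        obtain rfl : c = -1 := s1 ns (by linear_combination -1/8*h1)
        exact (l86 (-1)).k
      obtain rfl | rfl : e = -1/2 ∨ a = -1/2 := s3 (by linear_combination 1/8*h1)
      · exact (l47 a).k
      exact (l50 e).k
    replace h2 := r3 h2 n0 n3
    replace h9 := r3 h9 n3 ns
    obtain rfl | n4 := eq_or_ne e 0
    · obtain rfl | rfl : c = -1/2 ∨ a = -4/3*c - 4/3*d - 23/6 := s3 (by linear_combination -1/60*h1 + 1/15*h2)
      · obtain rfl | rfl : d = -2 ∨ d = -1/2 := s3 (by linear_combination 1/40*h1 + 1/20*h8)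
        · obtain rfl : a = -1/2 := by linear_combination -1/24*h1
          exact (l23 (-1/2)).k
        exact (l46 a).k
      obtain rfl : d = -c - 5/2 := s1 ns (by linear_combination -1/32*h1)
      exact (l23 c).k
    replace h3 := r3 h3 n0 n4
    replace h6 := r3 h6 n2 n4
    obtain rfl | rfl : c = -3/2 ∨ a = -3/2 := s3 (by linear_combination 1/20*h1 - 1/10*h3 + 1/10*h6)
    · obtain rfl : e = -d - 1 := s1 n3 (by linear_combination 3/80*h1 - 1/40*h3)
      obtain rfl | rfl : d = 1/2 ∨ a = -1/2 := s3 (by linear_combination 1/8*h1)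
      · exact (l58 a).k
      exact (l76 d).k
    obtain rfl : d = -c - 1 := s1 n2 (by linear_combination 3/40*h2 - 1/10*h9)
    obtain rfl | rfl : c = -1/2 ∨ e = -3/2 := s3 (by linear_combination -1/8*h1)
    · exact (l61 e).k
    exact (l86 c).k
  replace h7 := r3 h7 n1 ns
  obtain rfl | n2 := eq_or_ne c 0
  · obtain rfl | n3 := eq_or_ne d 0
    · obtain rfl | n4 := eq_or_ne e 0
      · obtain rfl | rfl : b = -5/2 ∨ b = -a - 1 := s3 (by linear_combination 1/6*h7)
        · exact (l11 a).k
        exact (l7 a).k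
      replace h3 := r3 h3 n0 n4
      replace h5 := r3 h5 n1 n4
      obtain rfl | rfl : e = -3/2 ∨ b = -a - 1 := s3 (by linear_combination 1/20*h3 - 1/20*h5)
      · obtain rfl | rfl : b = -3/2 ∨ b = -a - 5/2 := s3 (by linear_combination 1/8*h3)
        · exact (l45 a).k
        exact (l34 a).k
      obtain rfl : a = 1/2 := s1 n4 (by linear_combination 1/6*h7)
      exact (l49 e).k
    replace h2 := r3 h2 n0 n3
    replace h4 := r3 h4 n1 n3
    replace h9 := r3 h9 n3 ns
    obtain rfl | n4 := eq_or_ne e 0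
    · obtain rfl | rfl : b = -3/2 ∨ d = -3/2 := s3 (by linear_combination -1/20*h4 + 1/5*h7 + 1/5*h9)
      · obtain rfl : d = a - 3/2 := s1 n3 (by linear_combination -1/20*h2 + 1/20*h4 - 1/4*h7)
        obtain rfl : a = 1/2 := s1 n0 (by linear_combination 1/12*h2)
        exact (l75 (-1)).k
      obtain rfl | rfl : b = -1/2 ∨ b = -a - 3/2 := s3 (by linear_combination 1/8*h2)
      · exact (l44 a).k
      exact (l39 a).k
    replace h3 := r3 h3 n0 n4
    replace h5 := r3 h5 n1 n4
    obtain rfl | rfl : d = -1/2 ∨ b = -a - 1 := s3 (by linear_combination 1/60*h2 + 1/30*h3 - 1/60*h4 - 1/30*h5)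
    · obtain rfl : b = -3/2 := s1 n4 (by linear_combination 1/40*h2 + 1/20*h3 + 1/20*h4 - 3/10*h7 - 1/5*h9)
      obtain rfl : e = -1/2 := s1 n0 (by linear_combination 1/16*h2 + 1/8*h3)
      exact (l57 a).k
    obtain rfl | rfl : a = 1/2 ∨ d = -3/2 := s3 (by linear_combination -1/20*h3 - 1/10*h7)
    · obtain rfl : e = -d - 1 := s1 n3 (by linear_combination 1/8*h3)
      exact (l75 d).k
    obtain rfl | rfl : e = 1/2 ∨ a = -1/2 := s3 (by linear_combination 1/8*h2)
    · exact (l68 a).k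
    exact (l60 e).k
  replace h1 := r3 h1 n0 n2
  replace h8 := r3 h8 n2 ns
  obtain rfl | n3 := eq_or_ne d 0
  · obtain rfl | n4 := eq_or_ne e 0
    · obtain rfl | rfl : c = -3/2 ∨ c = -b - 5/2 := s3 (by linear_combination 1/20*h1 + 1/10*h8)
      · obtain rfl | rfl : b = 1/2 ∨ b = -a - 1/2 := s3 (by linear_combination -1/8*h1)
        · exact (l43 a).k
        exact (l42 a).k
      obtain rfl : a = 1/2 := s1 n1 (by linear_combination -1/12*h1)
      exact (l22 b).k
    replace h3 := r3 h3 n0 n4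
    replace h5 := r3 h5 n1 n4
    replace h6 := r3 h6 n2 n4
    obtain rfl | rfl : e = -3/2 ∨ c = -3/2 := s3 (by linear_combination 1/10*h1 - 1/10*h3 + 1/20*h6)
    · obtain rfl : c = -b - 1 := s1 n2 (by linear_combination 3/40*h3 - 1/10*h7)
      obtain rfl | rfl : b = -1/2 ∨ a = -3/2 := s3 (by linear_combination -1/12*h1)
      · exact (l56 a).k
      exact (l92 b).k
    obtain rfl : b = -a - 1 := s1 n4 (by linear_combination 3/40*h1 + 1/10*h7)
    obtain rfl | rfl : e = -1/2 ∨ a = -3/2 := s3 (by linear_combination -1/8*h1)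
    · exact (l67 a).k
    exact (l59 e).k
  replace h2 := r3 h2 n0 n3
  replace h4 := r3 h4 n1 n3
  replace h9 := r3 h9 n3 ns
  obtain rfl | n4 := eq_or_ne e 0
  · obtain rfl | rfl : d = -3/2 ∨ d = a + b - c := s3 (by linear_combination 1/10*h2 - 1/5*h7 - 1/10*h9)
    · obtain rfl : c = -b - 1 := s1 n2 (by linear_combination 3/40*h2 - 1/10*h7)
      obtain rfl | rfl : a = -1/2 ∨ b = -3/2 := s3 (by linear_combination -1/12*h1)
      · exact (l91 b).k
      exact (l55 a).k
    obtain rfl : b = -a - 1 := s1 n2 (by linear_combination -1/20*h2 + 3/20*h7)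
    obtain rfl | rfl : c = -1/2 ∨ a = 1/2 := s3 (by linear_combination 1/12*h1)
    · exact (l66 a).k
    exact (l78 c).k
  replace h3 := r3 h3 n0 n4
  replace h5 := r3 h5 n1 n4
  replace h6 := r3 h6 n2 n4
  obtain rfl | rfl : d = -1/2 ∨ b = -a - 1 := s3 (by linear_combination 1/60*h2 + 1/30*h3 - 1/60*h4 - 1/30*h5)
  · obtain rfl | rfl : c = -1/2 ∨ e = -1/2 := s3 (by linear_combination 1/10*h1 - 1/10*h3 + 1/20*h6)
    · obtain rfl | rfl : a = -1/2 ∨ e = -1/2 := s3 (by linear_combination -1/20*h3 + 1/20*h4)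
      · obtain rfl | rfl : b = -1/2 ∨ b = 2*e := s3 (by linear_combination -1/8*h1)
        · exact (l80 e).k
        obtain rfl | rfl : e = -1/2 ∨ e = -1/4 := s3 (by linear_combination 1/80*h3)
        · exact (l82 (-1/2)).k
        exact (l80 (-1/4)).k
      obtain rfl | rfl : b = -1/2 ∨ b = -a - 3/2 := s3 (by linear_combination -1/8*h1)
      · exact (l79 a).k
      exact (l82 a).k
    obtain rfl | rfl : a = -1/2 ∨ c = -1/2 := s3 (by linear_combination 1/20*h1 - 1/10*h2 + 1/5*h7)
    · obtain rfl | rfl : c = -1/2 ∨ c = -b - 3/2 := s3 (by linear_combination 1/40*h1 + 1/40*h2)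
      · obtain rfl | rfl : b = -1/2 ∨ b = -1 := s3 (by linear_combination -1/8*h1)
        · exact (l79 (-1/2)).k
        exact (l82 (-1/2)).k
      exact (l96 b).k
    obtain rfl | rfl : b = -1/2 ∨ b = -a - 3/2 := s3 (by linear_combination -1/8*h1)
    · exact (l79 a).k
    exact (l82 a).k
  obtain rfl : a = -1/2 := s1 n4 (by linear_combination -1/60*h1 + 1/12*h2 - 1/10*h7 + 1/15*h8 - 2/15*h9)
  obtain rfl | rfl : e = -1/2 ∨ c = -1/2 := s3 (by linear_combination -1/40*h1 + 1/20*h2 - 1/10*h7)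
  · obtain rfl | rfl : d = -1/2 ∨ d = -c - 3/2 := s3 (by linear_combination 3/80*h1 - 1/40*h2)
    · obtain rfl | rfl : c = -1/2 ∨ c = -1 := s3 (by linear_combination 1/16*h1)
      · exact (l79 (-1/2)).k
      exact (l90 (-1)).k
    exact (l90 c).k
  obtain rfl | rfl : d = -1/2 ∨ e = -d - 3/2 := s3 (by linear_combination 1/32*h1)
  · exact (l80 e).k
  exact (l84 d).k

theorem ev1 (a b c d e : ℂ) : eval ![a, b, c, d, e] (p 0) = a * c * q1 a b c d e := by
  simp [p, p1, q1]

theorem ev2 (a b c d e : ℂ) : eval ![a, b, c, d, e] (p 1) = a * d * q2 a b c d e := by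
  simp [p, p2, q2]

theorem ev3 (a b c d e : ℂ) : eval ![a, b, c, d, e] (p 2) = a * e * q3 a b c d e := by
  simp [p, p3, q3]

theorem ev4 (a b c d e : ℂ) : eval ![a, b, c, d, e] (p 3) = b * d * q4 a b c d e := by
  simp [p, p4, q4]

theorem ev5 (a b c d e : ℂ) : eval ![a, b, c, d, e] (p 4) = b * e * q5 a b c d e := by
  simp [p, p5, q5]

theorem ev6 (a b c d e : ℂ) : eval ![a, b, c, d, e] (p 5) = c * e * q6 a b c d e := by
  simp [p, p6, q6]

theorem ev7 (a b c d e : ℂ) : eval ![a, b, c, d, e] (p 6) = b * (7/2 + a + b + c + d + e) * q7 a b c d e := by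
  simp [p, p7, q7]

theorem ev8 (a b c d e : ℂ) : eval ![a, b, c, d, e] (p 7) = c * (7/2 + a + b + c + d + e) * q8 a b c d e := by
  simp [p, p8, q8]

theorem ev9 (a b c d e : ℂ) : eval ![a, b, c, d, e] (p 8) = d * (7/2 + a + b + c + d + e) * q9 a b c d e := by
  simp [p, p9, q9]

set_option maxHeartbeats 4000000 in
theorem van {a b c d e : ℂ} (h : Good a b c d e) (i : Fin 9) :
    eval ![a, b, c, d, e] (p i) = 0 := by
  fin_cases i
  · refine (ev1 ..).trans ?_; rw [q1]; cases h <;> ring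
  · refine (ev2 ..).trans ?_; rw [q2]; cases h <;> ring
  · refine (ev3 ..).trans ?_; rw [q3]; cases h <;> ring
  · refine (ev4 ..).trans ?_; rw [q4]; cases h <;> ring
  · refine (ev5 ..).trans ?_; rw [q5]; cases h <;> ring
  · refine (ev6 ..).trans ?_; rw [q6]; cases h <;> ring
  · refine (ev7 ..).trans ?_; rw [q7]; cases h <;> ring
  · refine (ev8 ..).trans ?_; rw [q8]; cases h <;> ring
  · refine (ev9 ..).trans ?_; rw [q9]; cases h <;> ring

set_option maxHeartbeats 4000000 in
theorem category_O_classification_sl6 (a : Fin 5 → ℂ) :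
    (∀ i : Fin 9, MvPolynomial.eval a (p i) = 0) ↔
      (∃ t : ℂ, a = ![t, 0, 0, 0, 0]) ∨
      (∃ t : ℂ, a = ![0, 0, 0, 0, t]) ∨
      (∃ t : ℂ, a = ![t, -t-7/2, 0, 0, 0]) ∨
      (∃ t : ℂ, a = ![0, t, -t-7/2, 0, 0]) ∨
      (∃ t : ℂ, a = ![0, 0, t, -t-7/2, 0]) ∨
      (∃ t : ℂ, a = ![0, 0, 0, t, -t-7/2]) ∨
      (∃ t : ℂ, a = ![t, -t-1, 0, 0, 0]) ∨
      (∃ t : ℂ, a = ![0, t, -t-1, 0, 0]) ∨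
      (∃ t : ℂ, a = ![0, 0, t, -t-1, 0]) ∨
      (∃ t : ℂ, a = ![0, 0, 0, t, -t-1]) ∨
      (∃ t : ℂ, a = ![t, -5/2, 0, 0, 0]) ∨
      (∃ t : ℂ, a = ![t, 0, -5/2, 0, 0]) ∨
      (∃ t : ℂ, a = ![t, 0, 0, -5/2, 0]) ∨
      (∃ t : ℂ, a = ![t, 0, 0, 0, -5/2]) ∨
      (∃ t : ℂ, a = ![-5/2, 0, 0, 0, t]) ∨
      (∃ t : ℂ, a = ![0, -5/2, 0, 0, t]) ∨
      (∃ t : ℂ, a = ![0, 0, -5/2, 0, t]) ∨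
      (∃ t : ℂ, a = ![0, 0, 0, -5/2, t]) ∨
      (∃ t : ℂ, a = ![-5/2, t, -1-t, 0, 0]) ∨
      (∃ t : ℂ, a = ![-5/2, 0, t, -1-t, 0]) ∨
      (∃ t : ℂ, a = ![-5/2, 0, 0, t, -1-t]) ∨
      (∃ t : ℂ, a = ![1/2, t, -5/2-t, 0, 0]) ∨
      (∃ t : ℂ, a = ![-1/2, 0, t, -5/2-t, 0]) ∨
      (∃ t : ℂ, a = ![-3/2, 0, 0, t, -5/2-t]) ∨
      (∃ t : ℂ, a = ![0, -5/2, t, -1-t, 0]) ∨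
      (∃ t : ℂ, a = ![0, -5/2, 0, t, -1-t]) ∨
      (∃ t : ℂ, a = ![0, -1/2, t, -3/2-t, 0]) ∨
      (∃ t : ℂ, a = ![0, -3/2, 0, t, -3/2-t]) ∨
      (∃ t : ℂ, a = ![0, 0, -5/2, t, -1-t]) ∨
      (∃ t : ℂ, a = ![0, 0, -3/2, t, -1/2-t]) ∨
      (∃ t : ℂ, a = ![t, -1-t, 0, 0, -5/2]) ∨
      (∃ t : ℂ, a = ![0, t, -1-t, 0, -5/2]) ∨
      (∃ t : ℂ, a = ![0, 0, t, -1-t, -5/2]) ∨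
      (∃ t : ℂ, a = ![t, -5/2-t, 0, 0, -3/2]) ∨
      (∃ t : ℂ, a = ![0, t, -5/2-t, 0, -1/2]) ∨
      (∃ t : ℂ, a = ![0, 0, t, -5/2-t, 1/2]) ∨
      (∃ t : ℂ, a = ![t, -1-t, 0, -5/2, 0]) ∨
      (∃ t : ℂ, a = ![0, t, -1-t, -5/2, 0]) ∨
      (∃ t : ℂ, a = ![t, -3/2-t, 0, -3/2, 0]) ∨
      (∃ t : ℂ, a = ![0, t, -3/2-t, -1/2, 0]) ∨
      (∃ t : ℂ, a = ![t, -1-t, -5/2, 0, 0]) ∨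
      (∃ t : ℂ, a = ![t, -1/2-t, -3/2, 0, 0]) ∨
      (∃ t : ℂ, a = ![t, 1/2, -3/2, 0, 0]) ∨
      (∃ t : ℂ, a = ![t, -1/2, 0, -3/2, 0]) ∨
      (∃ t : ℂ, a = ![t, -3/2, 0, 0, -3/2]) ∨
      (∃ t : ℂ, a = ![t, 0, -1/2, -1/2, 0]) ∨
      (∃ t : ℂ, a = ![t, 0, -3/2, 0, -1/2]) ∨
      (∃ t : ℂ, a = ![t, 0, 0, -3/2, 1/2]) ∨
      (∃ t : ℂ, a = ![1/2, -3/2, 0, 0, t]) ∨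
      (∃ t : ℂ, a = ![-1/2, 0, -3/2, 0, t]) ∨
      (∃ t : ℂ, a = ![-3/2, 0, 0, -3/2, t]) ∨
      (∃ t : ℂ, a = ![0, -1/2, -1/2, 0, t]) ∨
      (∃ t : ℂ, a = ![0, -3/2, 0, -1/2, t]) ∨
      (∃ t : ℂ, a = ![0, 0, -3/2, 1/2, t]) ∨
      (∃ t : ℂ, a = ![t, -3/2, 1/2, -3/2, 0]) ∨
      (∃ t : ℂ, a = ![t, -1/2, -1/2, 0, -3/2]) ∨
      (∃ t : ℂ, a = ![t, -3/2, 0, -1/2, -1/2]) ∨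
      (∃ t : ℂ, a = ![t, 0, -3/2, 1/2, -3/2]) ∨
      (∃ t : ℂ, a = ![-3/2, 1/2, -3/2, 0, t]) ∨
      (∃ t : ℂ, a = ![-1/2, -1/2, 0, -3/2, t]) ∨
      (∃ t : ℂ, a = ![-3/2, 0, -1/2, -1/2, t]) ∨
      (∃ t : ℂ, a = ![0, -3/2, 1/2, -3/2, t]) ∨
      (∃ t : ℂ, a = ![t, -5/2-t, 1/2, -3/2, 0]) ∨
      (∃ t : ℂ, a = ![t, -3/2-t, -1/2, 0, -3/2]) ∨
      (∃ t : ℂ, a = ![t, -5/2-t, 0, -1/2, -1/2]) ∨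
      (∃ t : ℂ, a = ![t, -1-t, -1/2, -1/2, 0]) ∨
      (∃ t : ℂ, a = ![t, -1-t, -3/2, 0, -1/2]) ∨
      (∃ t : ℂ, a = ![t, -1-t, 0, -3/2, 1/2]) ∨
      (∃ t : ℂ, a = ![0, t, -5/2-t, 1/2, -3/2]) ∨
      (∃ t : ℂ, a = ![0, t, -1-t, -3/2, 1/2]) ∨
      (∃ t : ℂ, a = ![-3/2, 1/2, t, -5/2-t, 0]) ∨
      (∃ t : ℂ, a = ![-1/2, -1/2, 0, t, -5/2-t]) ∨
      (∃ t : ℂ, a = ![-3/2, 0, -1/2, t, -3/2-t]) ∨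
      (∃ t : ℂ, a = ![0, -3/2, 1/2, t, -5/2-t]) ∨
      (∃ t : ℂ, a = ![1/2, -3/2, 0, t, -1-t]) ∨
      (∃ t : ℂ, a = ![-1/2, 0, -3/2, t, -1-t]) ∨
      (∃ t : ℂ, a = ![0, -1/2, -1/2, t, -1-t]) ∨
      (∃ t : ℂ, a = ![1/2, -3/2, t, -1-t, 0]) ∨
      (∃ t : ℂ, a = ![t, -1/2, -1/2, -1/2, -1/2]) ∨
      (∃ t : ℂ, a = ![-1/2, -1/2, -1/2, -1/2, t]) ∨
      (∃ t : ℂ, a = ![t, -1-t, -3/2, 1/2, -3/2]) ∨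
      (∃ t : ℂ, a = ![t, -3/2-t, -1/2, -1/2, -1/2]) ∨
      (∃ t : ℂ, a = ![-3/2, 1/2, -3/2, t, -1-t]) ∨
      (∃ t : ℂ, a = ![-1/2, -1/2, -1/2, t, -3/2-t]) ∨
      (∃ t : ℂ, a = ![0, -3/2, t, -1-t, -1/2]) ∨
      (∃ t : ℂ, a = ![-3/2, 0, t, -1-t, -3/2]) ∨
      (∃ t : ℂ, a = ![0, -3/2, t, -1/2-t, -3/2]) ∨
      (∃ t : ℂ, a = ![-1/2, -1/2, t, -1-t, -3/2]) ∨
      (∃ t : ℂ, a = ![-3/2, 0, t, -3/2-t, -1/2]) ∨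
      (∃ t : ℂ, a = ![-1/2, -1/2, t, -3/2-t, -1/2]) ∨
      (∃ t : ℂ, a = ![-1/2, t, -1-t, -3/2, 0]) ∨
      (∃ t : ℂ, a = ![-3/2, t, -1-t, 0, -3/2]) ∨
      (∃ t : ℂ, a = ![-3/2, t, -1/2-t, -3/2, 0]) ∨
      (∃ t : ℂ, a = ![-3/2, t, -1-t, -1/2, -1/2]) ∨
      (∃ t : ℂ, a = ![-1/2, t, -3/2-t, 0, -3/2]) ∨
      (∃ t : ℂ, a = ![-1/2, t, -3/2-t, -1/2, -1/2]) := by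
  constructor
  · have ea : a = ![a 0, a 1, a 2, a 3, a 4] := by
      ext i; fin_cases i <;> rfl
    rw [ea]
    generalize a 0 = a, a 1 = b, a 2 = c, a 3 = d, a 4 = e
    intro h
    have g : Good a b c d e := by
      have h0 := (ev1 ..).symm.trans (h 0)
      have h1 := (ev2 ..).symm.trans (h 1)
      have h2 := (ev3 ..).symm.trans (h 2)
      have h3 := (ev4 ..).symm.trans (h 3)
      have h4 := (ev5 ..).symm.trans (h 4)
      have h5 := (ev6 ..).symm.trans (h 5)
      by_cases s : 7/2 + a + b + c + d + e = 0
      · exact coreZ a b c d e s h0 h1 h2 h3 h4 h5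
      · exact coreU a b c d e s h0 h1 h2 h3 h4 h5 ((ev7 ..).symm.trans (h 6))
          ((ev8 ..).symm.trans (h 7)) ((ev9 ..).symm.trans (h 8))
    clear h
    cases g
    iterate 95
      exact Or.inl ⟨_, rfl⟩
      all_goals apply Or.inr
    exact ⟨_, rfl⟩
  · intro h i
    suffices g : ∃ b c d e f, a = ![b, c, d, e, f] ∧ Good b c d e f by
      obtain ⟨b, c, d, e, f, rfl, g⟩ := g
      exact van g i
    revert h
    repeat' refine or_imp.2 ⟨?_, ?_⟩
    all_goals
      rintro ⟨t, rfl⟩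
      refine ⟨_, _, _, _, _, rfl, ?_⟩
      with_reducible constructor
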